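/- arXiv:1401.6418 — 2 statements merged into one kernel-verified Lean document; each statement's English description precedes it below -/
import Mathlib

section
/- For every maximal s-collection F in 2^[n], there is a finite sequence of maximal s-collections starting at I_n and ending at F, and a finite sequence of maximal s-collections starting at F and ending at co-I_n, in each of which every next collection is obtained from the previous one by a strong raising flip. In particular, I_n and co-I_n are maximal s-collections in 2^[n]. -/
open Finset

/-- max of a finite set of naturals, with the convention `max0 ∅ = 0`. -/
def max0 (A : Finset ℕ) : ℕ := if h : A.Nonempty then A.max' h else 0

/-- min of a finite set of naturals, with the convention `min0 ∅ = 0`. -/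
def min0 (A : Finset ℕ) : ℕ := if h : A.Nonempty then A.min' h else 0

/-- `A < B` : global dominating, i.e. `max A < min B` (with `min ∅ = max ∅ = 0`). -/
def SetLT (A B : Finset ℕ) : Prop := max0 A < min0 B

/-- `A ⋖ B` : global dominating after cancelations, i.e. `(A − B) < (B − A)`. -/
def LessDot (A B : Finset ℕ) : Prop := SetLT (A \ B) (B \ A)

/-- `A ▷ B` (splitting): `A − B ≠ ∅` and `B − A` is a union of nonempty subsets
`B′, B″` with `B′ < (A − B) < B″`. -/
def Splits (A B : Finset ℕ) : Prop :=
  (A \ B).Nonempty ∧ ∃ B' B'' : Finset ℕ, B'.Nonempty ∧ B''.Nonempty ∧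
    B' ∪ B'' = B \ A ∧ SetLT B' (A \ B) ∧ SetLT (A \ B) B''

/-- `A` and `B` are strongly separated. -/
def StronglySep (A B : Finset ℕ) : Prop := LessDot A B ∨ LessDot B A ∨ A = B

/-- `A` and `B` are weakly separated. -/
def WeaklySep (A B : Finset ℕ) : Prop :=
  StronglySep A B ∨ (Splits A B ∧ B.card ≤ A.card) ∨ (Splits B A ∧ A.card ≤ B.card)

/-- a w-collection: members are pairwise weakly separated. -/
def IsWColl (F : Finset (Finset ℕ)) : Prop := ∀ A ∈ F, ∀ B ∈ F, WeaklySep A B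

/-- a maximal w-collection in the domain `D`. -/
def IsMaxWColl (D : Set (Finset ℕ)) (F : Finset (Finset ℕ)) : Prop :=
  ↑F ⊆ D ∧ IsWColl F ∧
    ∀ G : Finset (Finset ℕ), ↑G ⊆ D → IsWColl G → F ⊆ G → F = G

/-- the domain `D` is w-pure: all maximal w-collections in `D` have the same cardinality. -/
def WPure (D : Set (Finset ℕ)) : Prop :=
  ∀ F G : Finset (Finset ℕ), IsMaxWColl D F → IsMaxWColl D G → F.card = G.card

/-- an s-collection: members are pairwise strongly separated. -/
def IsSColl (F : Finset (Finset ℕ)) : Prop := ∀ A ∈ F, ∀ B ∈ F, StronglySep A B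

/-- a maximal s-collection in the domain `D`. -/
def IsMaxSColl (D : Set (Finset ℕ)) (F : Finset (Finset ℕ)) : Prop :=
  ↑F ⊆ D ∧ IsSColl F ∧
    ∀ G : Finset (Finset ℕ), ↑G ⊆ D → IsSColl G → F ⊆ G → F = G

/-- the domain `D` is s-pure: all maximal s-collections in `D` have the same cardinality. -/
def SPure (D : Set (Finset ℕ)) : Prop :=
  ∀ F G : Finset (Finset ℕ), IsMaxSColl D F → IsMaxSColl D G → F.card = G.card

/-- `I_n`: the collection of all intervals `{p,…,q} ⊆ [n]` together with `∅`. -/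
def IntervalColl (n : ℕ) : Finset (Finset ℕ) :=
  insert ∅ ((Finset.Icc 1 n ×ˢ Finset.Icc 1 n).image fun p => Finset.Icc p.1 p.2)

/-- `co-I_n`: the collection of complements in `[n]` of members of `I_n`. -/
def CoIntervalColl (n : ℕ) : Finset (Finset ℕ) :=
  (IntervalColl n).image fun X => Finset.Icc 1 n \ X

/-- `F′` is obtained from `F` by a strong raising flip. -/
def StrongRaisingFlip (n : ℕ) (F F' : Finset (Finset ℕ)) : Prop :=
  ∃ i j k : ℕ, ∃ X : Finset ℕ,
    i ∈ Finset.Icc 1 n ∧ j ∈ Finset.Icc 1 n ∧ k ∈ Finset.Icc 1 n ∧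
    i < j ∧ j < k ∧ X ⊆ Finset.Icc 1 n ∧ i ∉ X ∧ j ∉ X ∧ k ∉ X ∧
    X ∈ F ∧ insert i X ∈ F ∧ insert k X ∈ F ∧ insert i (insert j X) ∈ F ∧
    insert j (insert k X) ∈ F ∧ insert i (insert j (insert k X)) ∈ F ∧
    insert j X ∈ F ∧
    F' = insert (insert i (insert k X)) (F.erase (insert j X))

/-- `A` and `B` interlace: two elements of `A − B` enclose an element of `B − A`. -/
def Interlaced (A B : Finset ℕ) : Prop :=
  ∃ x y z, x < y ∧ y < z ∧ (x ∈ A ∧ x ∉ B) ∧ (y ∈ B ∧ y ∉ A) ∧ (z ∈ A ∧ z ∉ B)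

/-- Neither of the two sets interlaces the other one. -/
def Separated (A B : Finset ℕ) : Prop := ¬ Interlaced A B ∧ ¬ Interlaced B A

theorem Separated.symm {A B : Finset ℕ} (h : Separated A B) : Separated B A := ⟨h.2, h.1⟩

theorem separated_self (A : Finset ℕ) : Separated A A := by
  constructor <;> rintro ⟨x, y, z, _, _, hx, _, _⟩ <;> exact hx.2 hx.1

theorem setLT_iff {P Q : Finset ℕ} (hQ : 0 ∉ Q) :
    SetLT P Q ↔ Q.Nonempty ∧ ∀ p ∈ P, ∀ q ∈ Q, p < q := by
  unfold SetLT max0 min0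
  by_cases hq : Q.Nonempty
  · by_cases hp : P.Nonempty
    · simp only [hp, hq, dif_pos, true_and, Finset.max'_lt_iff, Finset.lt_min'_iff]
      exact ⟨fun h p hp q hq => h q hq p hp, fun h q hq p hp => h p hp q hq⟩
    · rw [Finset.not_nonempty_iff_eq_empty] at hp
      subst hp
      simp only [Finset.not_nonempty_empty, dif_neg, not_false_eq_true, hq, dif_pos, true_and,
        Finset.lt_min'_iff]
      refine ⟨fun _ p hp => by simp at hp, fun _ q hq => ?_⟩
      exact Nat.pos_of_ne_zero fun h => hQ (h ▸ hq)
  · simp [hq]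

theorem lessDot_iff {A B : Finset ℕ} (hB : 0 ∉ B) :
    LessDot A B ↔ (∃ b, b ∈ B ∧ b ∉ A) ∧
      ∀ a ∈ A, a ∉ B → ∀ b ∈ B, b ∉ A → a < b := by
  unfold LessDot
  rw [setLT_iff (by simp [hB])]
  simp only [Finset.Nonempty, Finset.mem_sdiff, and_imp]

theorem stronglySep_iff_separated {A B : Finset ℕ} (hA : 0 ∉ A) (hB : 0 ∉ B) :
    StronglySep A B ↔ Separated A B := by
  unfold StronglySep
  rw [lessDot_iff hA, lessDot_iff hB]
  constructor
  · rintro (⟨-, h⟩ | ⟨-, h⟩ | rfl)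
    · constructor <;> rintro ⟨x, y, z, hxy, hyz, hx, hy, hz⟩
      · have := h z hz.1 hz.2 y hy.1 hy.2; omega
      · have := h y hy.1 hy.2 x hx.1 hx.2; omega
    · constructor <;> rintro ⟨x, y, z, hxy, hyz, hx, hy, hz⟩
      · have := h y hy.1 hy.2 x hx.1 hx.2; omega
      · have := h z hz.1 hz.2 y hy.1 hy.2; omega
    · exact separated_self A
  · rintro ⟨h₁, h₂⟩
    by_cases hAB : A ⊆ B
    · by_cases hBA : B ⊆ A
      · exact .inr (.inr (hAB.antisymm hBA))
      · obtain ⟨b, hb⟩ := Finset.not_subset.1 hBA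
        exact .inl ⟨⟨b, hb⟩, fun a ha ha' => absurd (hAB ha) ha'⟩
    · obtain ⟨a₀, ha₀⟩ := Finset.not_subset.1 hAB
      by_cases hBA : B ⊆ A
      · exact .inr (.inl ⟨⟨a₀, ha₀⟩, fun a ha ha' => absurd (hBA ha) ha'⟩)
      · obtain ⟨b₀, hb₀⟩ := Finset.not_subset.1 hBA
        by_contra! hcon
        obtain ⟨a, ha, ha', b, hb, hb', hab⟩ := hcon.1 ⟨b₀, hb₀⟩
        obtain ⟨d, hd, hd', c, hc, hc', hcd⟩ := hcon.2.1 ⟨a₀, ha₀⟩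
        have h1 : b < a := lt_of_le_of_ne hab fun h => ha' (h ▸ hb)
        have h2 : c < d := lt_of_le_of_ne hcd fun h => hc' (h ▸ hd)
        rcases lt_trichotomy b c with h | h | h
        · exact h₂ ⟨b, c, d, h, h2, ⟨hb, hb'⟩, ⟨hc, hc'⟩, ⟨hd, hd'⟩⟩
        · exact hb' (h ▸ hc)
        · exact h₁ ⟨c, b, a, h, h1, ⟨hc, hc'⟩, ⟨hb, hb'⟩, ⟨ha, ha'⟩⟩

/-- A pairwise separated family of subsets of `[n]` containing every subset of `[n]` that is
separated from all its members. -/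
structure IsMaxSeparated (n : ℕ) (F : Finset (Finset ℕ)) : Prop where
  subset : ∀ A ∈ F, A ⊆ Finset.Icc 1 n
  separated : ∀ A ∈ F, ∀ B ∈ F, Separated A B
  mem : ∀ Z ⊆ Finset.Icc 1 n, (∀ B ∈ F, Separated Z B) → Z ∈ F

theorem isMaxSColl_iff {n : ℕ} {F : Finset (Finset ℕ)} :
    IsMaxSColl {X : Finset ℕ | X ⊆ Finset.Icc 1 n} F ↔ IsMaxSeparated n F := by
  have h0 : ∀ A : Finset ℕ, A ⊆ Finset.Icc 1 n → 0 ∉ A := fun A hA h => by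
    simpa using hA h
  constructor
  · rintro ⟨hs, hF, hm⟩
    have hs' : ∀ A ∈ F, A ⊆ Finset.Icc 1 n := fun A hA => hs hA
    have hsep : ∀ A ∈ F, ∀ B ∈ F, Separated A B := fun A hA B hB =>
      (stronglySep_iff_separated (h0 _ (hs' A hA)) (h0 _ (hs' B hB))).1 (hF A hA B hB)
    refine ⟨hs', hsep, fun Z hZ h => ?_⟩
    have hsub : ∀ A ∈ insert Z F, A ⊆ Finset.Icc 1 n := by
      intro A hA
      rcases Finset.mem_insert.1 hA with rfl | hA
      · exact hZ
      · exact hs' A hA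
    rw [hm (insert Z F) (fun A hA => hsub A hA) ?_ (Finset.subset_insert _ _)]
    · exact Finset.mem_insert_self _ _
    · intro A hA B hB
      rw [stronglySep_iff_separated (h0 _ (hsub A hA)) (h0 _ (hsub B hB))]
      rcases Finset.mem_insert.1 hA with hA | hA <;> rcases Finset.mem_insert.1 hB with hB | hB
      · exact hA ▸ hB ▸ separated_self _
      · exact hA ▸ h B hB
      · exact hB ▸ (h A hA).symm
      · exact hsep A hA B hB
  · rintro ⟨hs, hsep, hm⟩
    refine ⟨fun A hA => hs A hA, fun A hA B hB =>
      (stronglySep_iff_separated (h0 _ (hs A hA)) (h0 _ (hs B hB))).2 (hsep A hA B hB), ?_⟩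
    intro G hG hGs hFG
    refine hFG.antisymm fun Z hZ => hm Z (hG hZ) fun B hB => ?_
    exact (stronglySep_iff_separated (h0 _ (hG hZ)) (h0 _ (hs B hB))).1 (hGs Z hZ B (hFG hB))

theorem IsMaxSeparated.exists_not_separated {n : ℕ} {F : Finset (Finset ℕ)}
    (hF : IsMaxSeparated n F) {Z : Finset ℕ} (hZ : Z ⊆ Finset.Icc 1 n) (h : Z ∉ F) :
    ∃ B ∈ F, ¬ Separated Z B := by
  by_contra! hcon
  exact h (hF.mem Z hZ hcon)

theorem mem_intervalColl {n : ℕ} {Z : Finset ℕ} :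
    Z ∈ IntervalColl n ↔ Z ⊆ Finset.Icc 1 n ∧
      ∀ x y z, x < y → y < z → x ∈ Z → z ∈ Z → y ∈ Z := by
  unfold IntervalColl
  constructor
  · intro h
    rcases Finset.mem_insert.1 h with rfl | h
    · simp
    · obtain ⟨⟨p, q⟩, hpq, rfl⟩ := Finset.mem_image.1 h
      simp only [Finset.mem_product, Finset.mem_Icc] at hpq
      refine ⟨Finset.Icc_subset_Icc hpq.1.1 hpq.2.2, ?_⟩
      intro x y z hxy hyz hx hz
      simp only [Finset.mem_Icc] at *
      omega
  · rintro ⟨hs, hc⟩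
    rcases Z.eq_empty_or_nonempty with rfl | hne
    · simp
    · refine Finset.mem_insert_of_mem (Finset.mem_image.2 ⟨(Z.min' hne, Z.max' hne), ?_, ?_⟩)
      · exact Finset.mem_product.2 ⟨hs (Z.min'_mem hne), hs (Z.max'_mem hne)⟩
      · ext y
        simp only [Finset.mem_Icc]
        constructor
        · rintro ⟨h1, h2⟩
          rcases h1.eq_or_lt with h1 | h1
          · exact h1 ▸ Z.min'_mem hne
          rcases h2.eq_or_lt with h2 | h2
          · exact h2 ▸ Z.max'_mem hne
          exact hc _ _ _ h1 h2 (Z.min'_mem hne) (Z.max'_mem hne)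
        · exact fun hy => ⟨Z.min'_le _ hy, Z.le_max' _ hy⟩

theorem isMaxSeparated_intervalColl (n : ℕ) : IsMaxSeparated n (IntervalColl n) where
  subset A hA := (mem_intervalColl.1 hA).1
  separated A hA B hB := by
    constructor <;> rintro ⟨x, y, z, hxy, hyz, hx, hy, hz⟩
    · exact hy.2 ((mem_intervalColl.1 hA).2 x y z hxy hyz hx.1 hz.1)
    · exact hy.2 ((mem_intervalColl.1 hB).2 x y z hxy hyz hx.1 hz.1)
  mem Z hZ h := by
    refine mem_intervalColl.2 ⟨hZ, fun x y z hxy hyz hx hz => ?_⟩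
    by_contra hy
    have hyn : y ∈ Finset.Icc 1 n := by
      have h1 := Finset.mem_Icc.1 (hZ hx)
      have h2 := Finset.mem_Icc.1 (hZ hz)
      exact Finset.mem_Icc.2 (by omega)
    refine (h {y} (mem_intervalColl.2 ⟨by simpa using hyn, ?_⟩)).1
      ⟨x, y, z, hxy, hyz, ⟨hx, ?_⟩, ⟨by simp, hy⟩, ⟨hz, ?_⟩⟩ <;> grind

theorem IsMaxSeparated.eq_of_subset {n : ℕ} {F G : Finset (Finset ℕ)}
    (hF : IsMaxSeparated n F) (hG : IsMaxSeparated n G) (h : F ⊆ G) : F = G :=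
  h.antisymm fun Z hZ => hF.mem Z (hG.subset Z hZ) fun B hB => hG.separated Z hZ B (h hB)

theorem IsMaxSeparated.exists_insert_mem_of_forall_not_ssubset {n : ℕ} {F : Finset (Finset ℕ)}
    (hF : IsMaxSeparated n F) {Y Z : Finset ℕ} (hY : Y ∈ F) (hZ : Z ∈ F) (hYZ : Y ⊂ Z)
    (hmin : ∀ B ∈ F, Y ⊂ B → ¬ B ⊂ Z) : ∃ c ∈ Z, c ∉ Y ∧ insert c Y ∈ F := by
  by_contra! hcon
  have hsub := hYZ.1
  let L : ℕ → Prop := fun c => ∃ B ∈ F, c ∉ B ∧ (∃ s ∈ B, s ∈ Z ∧ s ∉ Y ∧ s < c) ∧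
    ((∃ l ∈ B, l ∉ Z ∧ ∀ u ∈ Z, u ∉ Y → u ∉ B → u < l) ∨
      ∃ l ∈ Y, l ∉ B ∧ ∀ u ∈ B, u ∉ Y → l < u)
  let R : ℕ → Prop := fun c => ∃ B ∈ F, c ∉ B ∧ (∃ s ∈ B, s ∈ Z ∧ s ∉ Y ∧ c < s) ∧
    ((∃ r ∈ B, r ∉ Z ∧ ∀ u ∈ Z, u ∉ Y → u ∉ B → r < u) ∨
      ∃ r ∈ Y, r ∉ B ∧ ∀ u ∈ B, u ∉ Y → u < r)
  have key : ∀ c ∈ Z, c ∉ Y → L c ∨ R c := by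
    intro c hcZ hcY
    obtain ⟨B, hB, hnot⟩ := hF.exists_not_separated
      (Finset.insert_subset (hF.subset Z hZ hcZ) (hF.subset Y hY)) (hcon c hcZ hcY)
    have hYB := hF.separated Y hY B hB
    have hZB := hF.separated Z hZ B hB
    have hcB : c ∉ B := by
      intro hcB
      apply hnot
      constructor
      · rintro ⟨x, y, z, hxy, hyz, hx, hy, hz⟩
        exact hYB.1 ⟨x, y, z, hxy, hyz, by grind, by grind, by grind⟩
      · rintro ⟨x, y, z, hxy, hyz, hx, hy, hz⟩
        exact hYB.2 ⟨x, y, z, hxy, hyz, by grind, by grind, by grind⟩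
    by_cases hYsub : Y ⊆ B
    · obtain ⟨x, z, hxc, hcz, hx, hxY, hz, hzY⟩ :
          ∃ x z, x < c ∧ c < z ∧ x ∈ B ∧ x ∉ Y ∧ z ∈ B ∧ z ∉ Y := by
        by_contra hne
        refine hnot ⟨?_, ?_⟩
        · rintro ⟨x, y, z, hxy, hyz, ⟨hx, hxB⟩, -, hz, hzB⟩
          have h1 := (Finset.mem_insert.1 hx).resolve_right fun h => hxB (hYsub h)
          have h2 := (Finset.mem_insert.1 hz).resolve_right fun h => hzB (hYsub h)
          omega
        · rintro ⟨x, y, z, hxy, hyz, ⟨hx, hxY⟩, ⟨hy, hyB⟩, hz, hzY⟩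
          obtain rfl := (Finset.mem_insert.1 hy).resolve_right fun h => hyB (hYsub h)
          exact hne ⟨x, z, hxy, hyz, hx, fun h => hxY (Finset.mem_insert_of_mem h), hz,
            fun h => hzY (Finset.mem_insert_of_mem h)⟩
      have hss : Y ⊂ B := ⟨hYsub, fun h => hzY (h hz)⟩
      obtain ⟨r, hrB, hrZ⟩ : ∃ r ∈ B, r ∉ Z := by
        refine Finset.not_subset.1 fun h => hmin B hB hss ⟨h, fun h' => hcB (h' hcZ)⟩
      rcases lt_trichotomy r c with h | h | h
      · right
        refine ⟨B, hB, hcB, ⟨z, hz, ?_, hzY, hcz⟩, .inl ⟨r, hrB, hrZ, fun u huZ huY huB => ?_⟩⟩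
        · by_contra hzZ
          exact hZB.2 ⟨r, c, z, h, hcz, ⟨hrB, hrZ⟩, ⟨hcZ, hcB⟩, hz, hzZ⟩
        · by_contra hur
          have : u ≠ r := fun h => hrZ (h ▸ huZ)
          exact hZB.1 ⟨u, r, c, by omega, h, ⟨huZ, huB⟩, ⟨hrB, hrZ⟩, hcZ, hcB⟩
      · exact absurd hrB (h ▸ hcB)
      · left
        refine ⟨B, hB, hcB, ⟨x, hx, ?_, hxY, hxc⟩, .inl ⟨r, hrB, hrZ, fun u huZ huY huB => ?_⟩⟩
        · by_contra hxZ
          exact hZB.2 ⟨x, c, r, hxc, h, ⟨hx, hxZ⟩, ⟨hcZ, hcB⟩, hrB, hrZ⟩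
        · by_contra hur
          have : u ≠ r := fun h => hrZ (h ▸ huZ)
          exact hZB.1 ⟨c, r, u, h, by omega, ⟨hcZ, hcB⟩, ⟨hrB, hrZ⟩, huZ, huB⟩
    · obtain ⟨t, htY, htB⟩ := Finset.not_subset.1 hYsub
      have hside : (∀ u ∈ B, u ∉ Y → u < t) ∨ (∀ u ∈ B, u ∉ Y → t < u) := by
        by_contra! hh
        obtain ⟨⟨u, huB, huY, hu⟩, v, hvB, hvY, hv⟩ := hh
        have h1 : u ≠ t := fun h => htB (h ▸ huB)
        have h2 : v ≠ t := fun h => htB (h ▸ hvB)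
        exact hYB.2 ⟨v, t, u, by omega, by omega, ⟨hvB, hvY⟩, ⟨htY, htB⟩, huB, huY⟩
      rcases hside with hside | hside
      · right
        obtain ⟨s, hsB, hsY, hcs⟩ : ∃ s ∈ B, s ∉ Y ∧ c < s := by
          by_contra! hne
          refine hnot ⟨?_, ?_⟩
          · rintro ⟨x, y, z, hxy, hyz, ⟨hx, hxB⟩, ⟨hy, hyY⟩, hz, hzB⟩
            have hyY' : y ∉ Y := fun h => hyY (Finset.mem_insert_of_mem h)
            have hyc := hne y hy hyY'
            rcases Finset.mem_insert.1 hx with rfl | hx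
            · omega
            · rcases Finset.mem_insert.1 hz with rfl | hz
              · exact hYB.1 ⟨x, y, t, hxy, hside y hy hyY',
                ⟨(Finset.mem_insert.1 hx).resolve_left (by omega), hxB⟩, ⟨hy, hyY'⟩, htY, htB⟩
              · exact hYB.1 ⟨x, y, z, hxy, hyz, ⟨hx, hxB⟩, ⟨hy, hyY'⟩, hz, hzB⟩
          · rintro ⟨x, y, z, hxy, hyz, ⟨hx, hxY⟩, ⟨hy, hyB⟩, hz, hzY⟩
            have hxY' : x ∉ Y := fun h => hxY (Finset.mem_insert_of_mem h)
            have hzY' : z ∉ Y := fun h => hzY (Finset.mem_insert_of_mem h)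
            rcases Finset.mem_insert.1 hy with rfl | hy
            · exact absurd (hne z hz hzY') (by omega)
            · exact hYB.2 ⟨x, y, z, hxy, hyz, ⟨hx, hxY'⟩, ⟨hy, hyB⟩, hz, hzY'⟩
        refine ⟨B, hB, hcB, ⟨s, hsB, ?_, hsY, hcs⟩, .inr ⟨t, htY, htB, hside⟩⟩
        by_contra hsZ
        exact hZB.1 ⟨c, s, t, hcs, hside s hsB hsY, ⟨hcZ, hcB⟩, ⟨hsB, hsZ⟩, hsub htY, htB⟩
      · left
        obtain ⟨s, hsB, hsY, hcs⟩ : ∃ s ∈ B, s ∉ Y ∧ s < c := by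
          by_contra! hne
          refine hnot ⟨?_, ?_⟩
          · rintro ⟨x, y, z, hxy, hyz, ⟨hx, hxB⟩, ⟨hy, hyY⟩, hz, hzB⟩
            have hyY' : y ∉ Y := fun h => hyY (Finset.mem_insert_of_mem h)
            have hyc := hne y hy hyY'
            rcases Finset.mem_insert.1 hx with rfl | hx
            · exact hYB.1 ⟨t, y, z, hside y hy hyY', hyz, ⟨htY, htB⟩, ⟨hy, hyY'⟩,
                (Finset.mem_insert.1 hz).resolve_left (by omega), hzB⟩
            · rcases Finset.mem_insert.1 hz with rfl | hz
              · omega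
              · exact hYB.1 ⟨x, y, z, hxy, hyz, ⟨hx, hxB⟩, ⟨hy, hyY'⟩, hz, hzB⟩
          · rintro ⟨x, y, z, hxy, hyz, ⟨hx, hxY⟩, ⟨hy, hyB⟩, hz, hzY⟩
            have hxY' : x ∉ Y := fun h => hxY (Finset.mem_insert_of_mem h)
            have hzY' : z ∉ Y := fun h => hzY (Finset.mem_insert_of_mem h)
            rcases Finset.mem_insert.1 hy with rfl | hy
            · exact absurd (hne x hx hxY') (by omega)
            · exact hYB.2 ⟨x, y, z, hxy, hyz, ⟨hx, hxY'⟩, ⟨hy, hyB⟩, hz, hzY'⟩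
        refine ⟨B, hB, hcB, ⟨s, hsB, ?_, hsY, hcs⟩, .inr ⟨t, htY, htB, hside⟩⟩
        by_contra hsZ
        exact hZB.1 ⟨t, s, c, hside s hsB hsY, hcs, ⟨hsub htY, htB⟩, ⟨hsB, hsZ⟩, hcZ, hcB⟩
  obtain ⟨c, hc, hcmax⟩ : ∃ c, (c ∈ Z ∧ c ∉ Y ∧ ¬ L c) ∧
      ∀ d, d ∈ Z → d ∉ Y → c < d → L d := by
    have hne : (Z \ Y).Nonempty := by
      obtain ⟨z, hz⟩ := Finset.not_subset.1 hYZ.2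
      exact ⟨z, Finset.mem_sdiff.2 hz⟩
    classical
    have hne' : ((Z \ Y).filter fun c => ¬ L c).Nonempty := by
      refine ⟨(Z \ Y).min' hne, Finset.mem_filter.2 ⟨Finset.min'_mem _ _, ?_⟩⟩
      rintro ⟨B, -, -, ⟨s, -, hsZ, hsY, hs⟩, -⟩
      exact absurd ((Z \ Y).min'_le s (Finset.mem_sdiff.2 ⟨hsZ, hsY⟩)) (not_le.2 hs)
    refine ⟨((Z \ Y).filter fun c => ¬ L c).max' hne', ?_, ?_⟩
    · have := Finset.max'_mem _ hne'
      simp only [Finset.mem_filter, Finset.mem_sdiff] at this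
      exact ⟨this.1.1, this.1.2, this.2⟩
    · intro d hdZ hdY hd
      by_contra hLd
      exact absurd (Finset.le_max' _ d (Finset.mem_filter.2 ⟨Finset.mem_sdiff.2 ⟨hdZ, hdY⟩, hLd⟩))
        (not_le.2 hd)
  obtain ⟨B, hB, hcB, ⟨s₁, hs₁⟩, hBr⟩ := (key c hc.1 hc.2.1).resolve_left hc.2.2
  obtain ⟨s, hs, hsmin⟩ : ∃ s, (s ∈ B ∧ s ∈ Z ∧ s ∉ Y ∧ c < s) ∧
      ∀ t, (t ∈ B ∧ t ∈ Z ∧ t ∉ Y ∧ c < t) → s ≤ t := by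
    classical
    have hex : ∃ s, s ∈ B ∧ s ∈ Z ∧ s ∉ Y ∧ c < s := ⟨s₁, hs₁⟩
    exact ⟨Nat.find hex, Nat.find_spec hex, fun t ht => Nat.find_min' hex ht⟩
  obtain ⟨B', hB', hsB', ⟨y₁, hy₁⟩, hBl⟩ := hcmax s hs.2.1 hs.2.2.1 hs.2.2.2
  obtain ⟨y, hyB', hyZ, hyY, hyB, hys⟩ : ∃ y, y ∈ B' ∧ y ∈ Z ∧ y ∉ Y ∧ y ∉ B ∧ y < s := by
    by_cases hcB' : c ∈ B'
    · exact ⟨c, hcB', hc.1, hc.2.1, hcB, hs.2.2.2⟩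
    · have hcy : c < y₁ := by
        by_contra hle
        have : y₁ ≠ c := fun h => hcB' (h ▸ hy₁.1)
        exact hc.2.2 ⟨B', hB', hcB', ⟨y₁, hy₁.1, hy₁.2.1, hy₁.2.2.1, by omega⟩, hBl⟩
      refine ⟨y₁, hy₁.1, hy₁.2.1, hy₁.2.2.1, fun h => ?_, hy₁.2.2.2⟩
      have := hsmin y₁ ⟨h, hy₁.2.1, hy₁.2.2.1, hcy⟩
      omega
  have hsep := hF.separated B hB B' hB'
  rcases hBr with ⟨r, hrB, hrZ, hr⟩ | ⟨r, hrY, hrB, hr⟩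
  · have hry := hr y hyZ hyY hyB
    by_cases hrB' : r ∈ B'
    · rcases hBl with ⟨l, hlB', hlZ, hl⟩ | ⟨l, hlY, hlB', hl⟩
      · exact (hF.separated B' hB' Z hZ).1
          ⟨r, s, l, by omega, hl s hs.2.1 hs.2.2.1 hsB', ⟨hrB', hrZ⟩, ⟨hs.2.1, hsB'⟩, hlB', hlZ⟩
      · exact (hF.separated B' hB' Z hZ).2
          ⟨l, r, s, hl r hrB' fun h => hrZ (hsub h), by omega, ⟨hsub hlY, hlB'⟩, ⟨hrB', hrZ⟩,
            hs.2.1, hsB'⟩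
    · exact hsep.1 ⟨r, y, s, hry, hys, ⟨hrB, hrB'⟩, ⟨hyB', hyB⟩, hs.1, hsB'⟩
  · have hsr := hr s hs.1 hs.2.2.1
    by_cases hrB' : r ∈ B'
    · exact hsep.2 ⟨y, s, r, hys, hsr, ⟨hyB', hyB⟩, ⟨hs.1, hsB'⟩, hrB', hrB⟩
    · rcases hBl with ⟨l, hlB', hlZ, hl⟩ | ⟨l, hlY, hlB', hl⟩
      · have hsl := hl s hs.2.1 hs.2.2.1 hsB'
        by_cases hlB : l ∈ B
        · exact (hF.separated B' hB' Z hZ).2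
            ⟨s, l, r, hsl, hr l hlB fun h => hlZ (hsub h), ⟨hs.2.1, hsB'⟩, ⟨hlB', hlZ⟩,
              hsub hrY, hrB'⟩
        · exact hsep.2 ⟨y, s, l, hys, hsl, ⟨hyB', hyB⟩, ⟨hs.1, hsB'⟩, hlB', hlB⟩
      · have hly := hl y hyB' hyY
        by_cases hlB : l ∈ B
        · exact hsep.1 ⟨l, y, s, hly, hys, ⟨hlB, hlB'⟩, ⟨hyB', hyB⟩, hs.1, hsB'⟩
        · exact (hF.separated Y hY B hB).1
            ⟨l, s, r, by omega, hsr, ⟨hlY, hlB⟩, ⟨hs.1, hs.2.2.1⟩, hrY, hrB⟩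

/-- In a maximal separated family every inclusion chain refines to one adding single elements. -/
theorem IsMaxSeparated.exists_insert_mem {n : ℕ} {F : Finset (Finset ℕ)}
    (hF : IsMaxSeparated n F) {Y Z : Finset ℕ} (hY : Y ∈ F) (hZ : Z ∈ F) (hYZ : Y ⊂ Z) :
    ∃ c ∈ Z, c ∉ Y ∧ insert c Y ∈ F := by
  induction Z using Finset.strongInduction with
  | H Z ih =>
    by_cases h : ∃ B ∈ F, Y ⊂ B ∧ B ⊂ Z
    · obtain ⟨B, hB, hYB, hBZ⟩ := h
      obtain ⟨c, hc, h⟩ := ih B hBZ hB hYB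
      exact ⟨c, hBZ.1 hc, h⟩
    · push Not at h
      exact hF.exists_insert_mem_of_forall_not_ssubset hY hZ hYZ h

/-- Two consecutive upward edges span a rhombus. -/
theorem IsMaxSeparated.insert_insert_mem {n : ℕ} {F : Finset (Finset ℕ)}
    (hF : IsMaxSeparated n F) {Y : Finset ℕ} {a b : ℕ} (hY : Y ∈ F) (ha : insert a Y ∈ F)
    (hb : insert b Y ∈ F) (hba : b < a)
    (hno : ∀ c, b < c → c < a → c ∉ Y → insert c Y ∉ F) : insert a (insert b Y) ∈ F := by
  by_contra hab
  obtain ⟨Z, hZ, hnot⟩ := hF.exists_not_separated (Z := insert a (insert b Y))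
    (Finset.insert_subset (hF.subset _ ha (Finset.mem_insert_self _ _)) (hF.subset _ hb)) hab
  have h0 := hF.separated Y hY Z hZ
  have h1 := hF.separated _ ha Z hZ
  have h2 := hF.separated _ hb Z hZ
  have mem {x : ℕ} : x ∈ insert a (insert b Y) ↔ x = a ∨ x = b ∨ x ∈ Y := by simp
  have hsurr : ¬ Interlaced (insert a (insert b Y)) Z →
      Interlaced Z (insert a (insert b Y)) := by
    intro h
    by_contra h'
    exact hnot ⟨h, h'⟩
  have hI : ¬ Interlaced Z (insert a (insert b Y)) := by
    rintro ⟨x, y, z, hxy, hyz, ⟨hx, hx'⟩, ⟨hy, hy'⟩, hz, hz'⟩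
    rw [mem] at hx' hz' hy
    push Not at hx' hz'
    rcases hy with rfl | rfl | hy
    · exact h1.2 ⟨x, y, z, hxy, hyz, ⟨hx, by simp [hx']⟩, ⟨by simp, hy'⟩, hz, by simp [hz']⟩
    · exact h2.2 ⟨x, y, z, hxy, hyz, ⟨hx, by simp [hx']⟩, ⟨by simp, hy'⟩, hz, by simp [hz']⟩
    · exact h0.2 ⟨x, y, z, hxy, hyz, ⟨hx, hx'.2.2⟩, ⟨hy, hy'⟩, hz, hz'.2.2⟩
  have hI' : Interlaced (insert a (insert b Y)) Z := by
    by_contra h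
    exact hI (hsurr h)
  obtain ⟨x, y, z, hxy, hyz, ⟨hx, hx'⟩, ⟨hy, hy'⟩, hz, hz'⟩ := hI'
  rw [mem] at hx hz hy'
  push Not at hy'
  have hxb : x = b := by
    rcases hx with rfl | hx
    · rcases hz with rfl | rfl | hz
      · omega
      · omega
      · exact (h1.1 ⟨x, y, z, hxy, hyz, ⟨by simp, hx'⟩, ⟨hy, by simp [hy']⟩, by simp [hz],
          hz'⟩).elim
    rcases hx with rfl | hx
    · rfl
    · rcases hz with rfl | rfl | hz
      · exact (h1.1 ⟨x, y, z, hxy, hyz, ⟨by simp [hx], hx'⟩, ⟨hy, by simp [hy']⟩, by simp,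
          hz'⟩).elim
      · exact (h2.1 ⟨x, y, z, hxy, hyz, ⟨by simp [hx], hx'⟩, ⟨hy, by simp [hy']⟩, by simp,
          hz'⟩).elim
      · exact (h0.1 ⟨x, y, z, hxy, hyz, ⟨hx, hx'⟩, ⟨hy, hy'.2.2⟩, hz, hz'⟩).elim
  subst hxb
  have hza : z = a := by
    rcases hz with rfl | rfl | hz
    · rfl
    · omega
    · exact (h2.1 ⟨x, y, z, hxy, hyz, ⟨by simp, hx'⟩, ⟨hy, by simp [hy']⟩, by simp [hz],
          hz'⟩).elim
  subst hza
  have hYZ : Y ⊆ Z := by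
    intro t ht
    by_contra htZ
    have hty : t ≠ y := fun h => htZ (h ▸ hy)
    rcases lt_or_gt_of_ne hty with h | h
    · exact h1.1 ⟨t, y, z, h, hyz, ⟨by simp [ht], htZ⟩, ⟨hy, by simp [hy']⟩, by simp, hz'⟩
    · exact h2.1 ⟨x, y, t, hxy, h, ⟨by simp, hx'⟩, ⟨hy, by simp [hy']⟩, by simp [ht], htZ⟩
  obtain ⟨c, hcZ, hcY, hc⟩ := hF.exists_insert_mem hY hZ ⟨hYZ, fun h => hy'.2.2 (h hy)⟩
  have hcx : c ≠ x := fun h => hx' (h ▸ hcZ)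
  have hcz : c ≠ z := fun h => hz' (h ▸ hcZ)
  refine hno c ?_ ?_ hcY hc
  · by_contra hlt
    exact h2.2 ⟨c, x, y, by omega, hxy, ⟨hcZ, by simp [hcx, hcY]⟩, ⟨by simp, hx'⟩, hy,
      by simp [hy']⟩
  · by_contra hlt
    exact h1.2 ⟨y, z, c, hyz, by omega, ⟨hy, by simp [hy']⟩, ⟨by simp, hz'⟩, hcZ,
      by simp [hcz, hcY]⟩

theorem IsMaxSeparated.Icc_mem {n : ℕ} {F : Finset (Finset ℕ)} (hF : IsMaxSeparated n F)
    {p : ℕ} (hp : 1 ≤ p) : Finset.Icc p n ∈ F := by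
  refine hF.mem _ (Finset.Icc_subset_Icc_left hp) fun B hB => ?_
  have hs := hF.subset B hB
  constructor <;> rintro ⟨x, y, z, hxy, hyz, ⟨hx, hx'⟩, ⟨hy, hy'⟩, hz, hz'⟩
  · have := Finset.mem_Icc.1 (hs hy)
    rw [Finset.mem_Icc] at hx hy'
    omega
  · have := Finset.mem_Icc.1 (hs hz)
    rw [Finset.mem_Icc] at hz' hy
    omega

theorem IsMaxSeparated.Icc_one_mem {n : ℕ} {F : Finset (Finset ℕ)} (hF : IsMaxSeparated n F)
    {p : ℕ} (hp : p ≤ n) : Finset.Icc 1 p ∈ F := by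
  refine hF.mem _ (Finset.Icc_subset_Icc_right hp) fun B hB => ?_
  have hs := hF.subset B hB
  constructor <;> rintro ⟨x, y, z, hxy, hyz, ⟨hx, hx'⟩, ⟨hy, hy'⟩, hz, hz'⟩
  · have := Finset.mem_Icc.1 (hs hy)
    rw [Finset.mem_Icc] at hz hy'
    omega
  · have := Finset.mem_Icc.1 (hs hx)
    rw [Finset.mem_Icc] at hx' hy
    omega

theorem IsMaxSeparated.empty_mem {n : ℕ} {F : Finset (Finset ℕ)} (hF : IsMaxSeparated n F) :
    ∅ ∈ F := by
  simpa using hF.Icc_one_mem n.zero_le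

theorem separated_insert_of_flip {X Y : Finset ℕ} {i j k : ℕ} (hij : i < j) (hjk : j < k)
    (hi : i ∉ X) (hj : j ∉ X) (hk : k ∉ X) (h0 : Separated Y X)
    (h1 : Separated Y (insert i (insert j X))) (h2 : Separated Y (insert j (insert k X)))
    (hne : Y ≠ insert i (insert k X)) : Separated Y (insert j X) := by
  constructor
  · rintro ⟨x, y, z, hxy, hyz, ⟨hx, hx'⟩, ⟨hy, hy'⟩, hz, hz'⟩
    simp only [Finset.mem_insert, not_or] at hx' hy hz'
    rcases hy with rfl | hy
    · have hxi : x = i := by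
        by_contra hxi
        exact h1.1 ⟨x, y, z, hxy, hyz, ⟨hx, by grind⟩, ⟨by simp, hy'⟩, hz, by grind⟩
      have hzk : z = k := by
        by_contra hzk
        exact h2.1 ⟨x, y, z, hxy, hyz, ⟨hx, by grind⟩, ⟨by simp, hy'⟩, hz, by grind⟩
      subst hxi hzk
      apply hne
      ext w
      constructor
      · intro hw
        by_contra hw'
        simp only [Finset.mem_insert, not_or] at hw'
        rcases lt_trichotomy w y with h | rfl | h
        · exact h1.1 ⟨w, y, z, h, hyz, ⟨hw, by grind⟩, ⟨by simp, hy'⟩, hz, by grind⟩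
        · exact hy' hw
        · exact h2.1 ⟨x, y, w, hxy, h, ⟨hx, by grind⟩, ⟨by simp, hy'⟩, hw, by grind⟩
      · intro hw
        simp only [Finset.mem_insert] at hw
        rcases hw with rfl | rfl | hw
        · exact hx
        · exact hz
        by_contra hw'
        rcases lt_trichotomy w x with h | rfl | h
        · exact h2.2 ⟨w, x, y, h, hxy, ⟨by simp [hw], hw'⟩, ⟨hx, by grind⟩, by simp, hy'⟩
        · exact hw' hx
        rcases lt_trichotomy w z with h' | rfl | h'
        · exact h0.1 ⟨x, w, z, h, h', ⟨hx, hx'.2⟩, ⟨hw, hw'⟩, hz, hz'.2⟩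
        · exact hw' hz
        · exact h1.2 ⟨y, z, w, hyz, h', ⟨by simp, hy'⟩, ⟨hz, by grind⟩, by simp [hw], hw'⟩
    · exact h0.1 ⟨x, y, z, hxy, hyz, ⟨hx, hx'.2⟩, ⟨hy, hy'⟩, hz, hz'.2⟩
  · rintro ⟨x, y, z, hxy, hyz, ⟨hx, hx'⟩, ⟨hy, hy'⟩, hz, hz'⟩
    simp only [Finset.mem_insert, not_or] at hx hy' hz
    rcases hx with rfl | hx
    · exact h1.2 ⟨x, y, z, hxy, hyz, ⟨by simp, hx'⟩, ⟨hy, by grind⟩, by grind, hz'⟩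
    rcases hz with rfl | hz
    · exact h2.2 ⟨x, y, z, hxy, hyz, ⟨by simp [hx], hx'⟩, ⟨hy, by grind⟩, by grind, hz'⟩
    · exact h0.2 ⟨x, y, z, hxy, hyz, ⟨hx, hx'⟩, ⟨hy, hy'.2⟩, hz, hz'⟩

theorem separated_insert_insert_of_flip {X Y : Finset ℕ} {i j k : ℕ} (hij : i < j) (hjk : j < k)
    (hi : i ∉ X) (hj : j ∉ X) (hk : k ∉ X) (h0 : Separated Y (insert i (insert j (insert k X))))
    (h1 : Separated Y (insert i X)) (h2 : Separated Y (insert k X))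
    (hne : Y ≠ insert j X) : Separated Y (insert i (insert k X)) := by
  constructor
  · rintro ⟨x, y, z, hxy, hyz, ⟨hx, hx'⟩, ⟨hy, hy'⟩, hz, hz'⟩
    simp only [Finset.mem_insert, not_or] at hx' hy hz'
    rcases eq_or_ne x j with rfl | hxj
    · exact h2.1 ⟨x, y, z, hxy, hyz, ⟨hx, by grind⟩, ⟨by grind, hy'⟩, hz, by grind⟩
    rcases eq_or_ne z j with rfl | hzj
    · exact h1.1 ⟨x, y, z, hxy, hyz, ⟨hx, by grind⟩, ⟨by grind, hy'⟩, hz, by grind⟩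
    · exact h0.1 ⟨x, y, z, hxy, hyz, ⟨hx, by grind⟩, ⟨by grind, hy'⟩, hz, by grind⟩
  · rintro ⟨x, y, z, hxy, hyz, ⟨hx, hx'⟩, ⟨hy, hy'⟩, hz, hz'⟩
    simp only [Finset.mem_insert, not_or] at hx hy' hz
    rcases eq_or_ne y j with rfl | hyj
    · have hxi : x = i := by
        by_contra hxi
        exact h2.2 ⟨x, y, z, hxy, hyz, ⟨by grind, hx'⟩, ⟨hy, by grind⟩, by grind, hz'⟩
      have hzk : z = k := by
        by_contra hzk
        exact h1.2 ⟨x, y, z, hxy, hyz, ⟨by grind, hx'⟩, ⟨hy, by grind⟩, by grind, hz'⟩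
      subst hxi hzk
      apply hne
      ext w
      constructor
      · intro hw
        by_contra hw'
        simp only [Finset.mem_insert, not_or] at hw'
        rcases lt_trichotomy w x with h | rfl | h
        · exact h1.1 ⟨w, x, y, h, hxy, ⟨hw, by grind⟩, ⟨by simp, hx'⟩, hy, by grind⟩
        · exact hx' hw
        rcases lt_trichotomy w z with h' | rfl | h'
        · exact h0.2 ⟨x, w, z, h, h', ⟨by simp, hx'⟩, ⟨hw, by grind⟩, by simp, hz'⟩
        · exact hz' hw
        · exact h2.1 ⟨y, z, w, hyz, h', ⟨hy, by grind⟩, ⟨by simp, hz'⟩, hw, by grind⟩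
      · intro hw
        simp only [Finset.mem_insert] at hw
        rcases hw with rfl | hw
        · exact hy
        by_contra hw'
        rcases lt_trichotomy w y with h | rfl | h
        · exact h2.2 ⟨w, y, z, h, hyz, ⟨by simp [hw], hw'⟩, ⟨hy, by grind⟩, by simp, hz'⟩
        · exact hw' hy
        · exact h1.2 ⟨x, y, w, hxy, h, ⟨by simp, hx'⟩, ⟨hy, by grind⟩, by simp [hw], hw'⟩
    · exact h0.2 ⟨x, y, z, hxy, hyz, ⟨by grind, hx'⟩, ⟨hy, by grind⟩, by grind, hz'⟩

/-- `F` contains the hexagon with bottom `X` and directions `i < j < k`, cut by the vertex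
`X ∪ {i, k}`. -/
def HasUpperHexagon (F : Finset (Finset ℕ)) (i j k : ℕ) (X : Finset ℕ) : Prop :=
  i < j ∧ j < k ∧ i ∉ X ∧ j ∉ X ∧ k ∉ X ∧ X ∈ F ∧ insert i X ∈ F ∧ insert k X ∈ F ∧
    insert i (insert j X) ∈ F ∧ insert j (insert k X) ∈ F ∧
    insert i (insert j (insert k X)) ∈ F ∧ insert i (insert k X) ∈ F

theorem IsMaxSeparated.exists_hexagon_of_top_mem {n : ℕ} {F : Finset (Finset ℕ)}
    (hF : IsMaxSeparated n F) {A : Finset ℕ} (hA : A ∈ F) (hnA : n ∈ A) {x y : ℕ}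
    (hxy : x < y) (hyn : y < n) (hx : x ∈ A) (hy : y ∉ A) :
    ∃ i j k X, HasUpperHexagon F i j k X := by
  obtain ⟨W, hW, hnW, hWn⟩ : ∃ W ∈ F, n ∈ W ∧ W.erase n ∉ F := by
    by_contra! h
    have h1 := h _ (hF.Icc_mem (p := y) (by omega)) (by simp; omega)
    refine (hF.separated A hA _ h1).1 ⟨x, y, n, hxy, hyn, ⟨hx, ?_⟩, ⟨?_, hy⟩, hnA, by simp⟩
    · simp; omega
    · simp; omega
  have hn1 : 1 ≤ n := (Finset.mem_Icc.1 (hF.subset A hA hnA)).1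
  let P : Finset ℕ → ℕ → Prop := fun X a => X ∈ F ∧ n ∉ X ∧ insert n X ∈ F ∧ a ∉ X ∧ a ≠ n ∧
    insert a (insert n X) ∈ F ∧ insert a X ∉ F
  have hP : ∃ X a, P X a := by
    have hne : (F.filter fun V => n ∈ V ∧ V ⊆ W ∧ V.erase n ∈ F).Nonempty := by
      refine ⟨{n}, Finset.mem_filter.2 ⟨?_, by simp, by simpa using hnW, ?_⟩⟩
      · simpa using hF.Icc_mem hn1
      · simpa using hF.empty_mem
    obtain ⟨V, hV, hmax⟩ := Finset.exists_max_image _ Finset.card hne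
    simp only [Finset.mem_filter] at hV hmax
    obtain ⟨hV, hnV, hVW, hVn⟩ := hV
    obtain ⟨c, hcW, hcV, hc⟩ := hF.exists_insert_mem hV hW
      ⟨hVW, fun h => hWn (hVW.antisymm h ▸ hVn)⟩
    have hcn : c ≠ n := fun h => hcV (h ▸ hnV)
    refine ⟨V.erase n, c, hVn, by simp, ?_, by simp [hcV], hcn, ?_, fun h => ?_⟩
    · rwa [Finset.insert_erase hnV]
    · rwa [Finset.insert_erase hnV]
    · have := hmax (insert c V) ⟨hc, by simp [hnV], Finset.insert_subset hcW hVW, by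
        rwa [Finset.erase_insert_of_ne hcn]⟩
      rw [Finset.card_insert_of_notMem hcV] at this
      omega
  classical
  have hne : (F.filter fun X => ∃ a, P X a).Nonempty := by
    obtain ⟨X, a, h⟩ := hP
    exact ⟨X, Finset.mem_filter.2 ⟨h.1, a, h⟩⟩
  obtain ⟨X, hX, hmax⟩ := Finset.exists_max_image _ Finset.card hne
  have hex := (Finset.mem_filter.1 hX).2
  obtain ⟨a, ⟨hXF, hnX, hnXF, haX, han, hanX, haXF⟩, hamin⟩ :
      ∃ a, P X a ∧ ∀ c, P X c → a ≤ c :=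
    ⟨Nat.find hex, Nat.find_spec hex, fun c hc => Nat.find_min' hex hc⟩
  have hXs : X ⊂ Finset.Icc 1 (n - 1) := by
    have hlt : ∀ t ∈ Finset.Icc 1 n, t ≠ n → t ∈ Finset.Icc 1 (n - 1) := by
      intro t ht htn
      rw [Finset.mem_Icc] at *
      omega
    refine ⟨fun t ht => hlt t (hF.subset X hXF ht) fun h => hnX (h ▸ ht), fun h => haX (h ?_)⟩
    exact hlt a (hF.subset _ hanX (Finset.mem_insert_self _ _)) han
  obtain ⟨b₀, hb₀, hb₀X, hb₀F⟩ := hF.exists_insert_mem hXF (hF.Icc_one_mem (n.sub_le 1)) hXs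
  have hne : ((Finset.Icc 1 (n - 1)).filter fun b => b ∉ X ∧ insert b X ∈ F).Nonempty :=
    ⟨b₀, Finset.mem_filter.2 ⟨hb₀, hb₀X, hb₀F⟩⟩
  obtain ⟨b, hb, hbmax⟩ := Finset.exists_max_image _ id hne
  simp only [Finset.mem_filter, id, Finset.mem_Icc] at hb hbmax
  obtain ⟨hbn, hbX, hbF⟩ := hb
  have hbn' : b < n := by omega
  have hnb : insert n (insert b X) ∈ F :=
    hF.insert_insert_mem hXF hnXF hbF hbn' fun c hbc hcn hcX hc => by
      have := hbmax c ⟨by omega, hcX, hc⟩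
      omega
  have hba : b < a := by
    by_contra hab
    have hne : a ≠ b := fun h => haXF (h ▸ hbF)
    exact (hF.separated _ hanX _ hbF).1 ⟨a, b, n, by omega, hbn', ⟨by simp, by simp [hne, haX]⟩,
      ⟨by simp, by simp [hne.symm, hbX, hbn'.ne]⟩, by simp, by simp [hnX, hbn'.ne']⟩
  have habn : insert a (insert b (insert n X)) ∈ F := by
    refine hF.insert_insert_mem hnXF hanX (by rwa [Finset.insert_comm]) hba ?_
    intro c hbc hca hcX hc
    rw [Finset.mem_insert, not_or] at hcX
    have hcF : insert c X ∉ F := fun h => by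
      have h1 := Finset.mem_Icc.1 (hF.subset _ h (Finset.mem_insert_self _ _))
      have := hbmax c ⟨by omega, hcX.2, h⟩
      omega
    have := hamin c ⟨hXF, hnX, hnXF, hcX.2, hcX.1, hc, hcF⟩
    omega
  have hab : insert a (insert b X) ∈ F := by
    by_contra h
    have := hmax (insert b X) (Finset.mem_filter.2 ⟨hbF, a, hbF, by simp [hnX, hbn'.ne'], hnb,
      by simp [haX, hba.ne'], han, by rwa [Finset.insert_comm n b], h⟩)
    rw [Finset.card_insert_of_notMem hbX] at this
    omega
  have han' : a < n := by
    have := Finset.mem_Icc.1 (hF.subset _ hanX (Finset.mem_insert_self _ _))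
    omega
  exact ⟨b, a, n, X, hba, han', hbX, haX, hnX, hXF, hbF, hnXF, by rwa [Finset.insert_comm], hanX,
    by rwa [Finset.insert_comm], by rwa [Finset.insert_comm]⟩

theorem IsMaxSeparated.exists_hexagon {n : ℕ} {F : Finset (Finset ℕ)}
    (hF : IsMaxSeparated n F) {A : Finset ℕ} (hA : A ∈ F) {x y z : ℕ}
    (hxy : x < y) (hyz : y < z) (hx : x ∈ A) (hy : y ∉ A) (hz : z ∈ A) :
    ∃ i j k X, HasUpperHexagon F i j k X := by
  induction n generalizing F A x y z with
  | zero => simpa using hF.subset A hA hx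
  | succ n ih =>
    by_cases h : ∃ B ∈ F, n + 1 ∈ B ∧ ∃ x y z, x < y ∧ y < z ∧ x ∈ B ∧ y ∉ B ∧ z ∈ B
    · obtain ⟨B, hB, hnB, x, y, z, hxy, hyz, hx, hy, hz⟩ := h
      have := Finset.mem_Icc.1 (hF.subset B hB hz)
      exact hF.exists_hexagon_of_top_mem hB hnB hxy (by omega) hx hy
    · have hconv : ∀ B ∈ F, n + 1 ∈ B → ∀ x y z, x < y → y < z → x ∈ B → z ∈ B → y ∈ B := by
        intro B hB hnB x y z hxy hyz hx hz
        by_contra hy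
        exact h ⟨B, hB, hnB, x, y, z, hxy, hyz, hx, hy, hz⟩
      have hF' : IsMaxSeparated n (F.filter fun B => n + 1 ∉ B) := by
        refine ⟨fun B hB t ht => ?_, fun B hB C hC => ?_, fun Z hZ hsep => ?_⟩
        · obtain ⟨hB, hnB⟩ := Finset.mem_filter.1 hB
          have := Finset.mem_Icc.1 (hF.subset B hB ht)
          have : t ≠ n + 1 := fun h => hnB (h ▸ ht)
          rw [Finset.mem_Icc]
          omega
        · exact hF.separated B (Finset.mem_filter.1 hB).1 C (Finset.mem_filter.1 hC).1
        · have hZn : n + 1 ∉ Z := fun h => by simpa using hZ h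
          refine Finset.mem_filter.2 ⟨hF.mem Z (hZ.trans (Finset.Icc_subset_Icc_right n.le_succ))
            fun B hB => ?_, hZn⟩
          by_cases hnB : n + 1 ∈ B
          · constructor <;> rintro ⟨x, y, z, hxy, hyz, ⟨hx, hx'⟩, ⟨hy, hy'⟩, hz, hz'⟩
            · have := Finset.mem_Icc.1 (hZ hz)
              exact hz' (hconv B hB hnB y z (n + 1) hyz (by omega) hy hnB)
            · exact hy' (hconv B hB hnB x y z hxy hyz hx hz)
          · exact hsep B (Finset.mem_filter.2 ⟨hB, hnB⟩)
      have hAn : n + 1 ∉ A := fun hnA => hy (hconv A hA hnA x y z hxy hyz hx hz)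
      obtain ⟨i, j, k, X, hij, hjk, hi, hj, hk, h⟩ :=
        ih hF' (Finset.mem_filter.2 ⟨hA, hAn⟩) hxy hyz hx hy hz
      simp only [Finset.mem_filter] at h
      exact ⟨i, j, k, X, hij, hjk, hi, hj, hk, h.1.1, h.2.1.1, h.2.2.1.1, h.2.2.2.1.1,
        h.2.2.2.2.1.1, h.2.2.2.2.2.1.1, h.2.2.2.2.2.2.1⟩

theorem not_separated_insert {X : Finset ℕ} {i j k : ℕ} (hij : i < j) (hjk : j < k)
    (hi : i ∉ X) (hj : j ∉ X) (hk : k ∉ X) :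
    ¬ Separated (insert i (insert k X)) (insert j X) := fun h =>
  h.1 ⟨i, j, k, hij, hjk, ⟨by simp, by simp [hi, hij.ne]⟩,
    ⟨by simp, by simp [hj, hij.ne', hjk.ne]⟩, by simp, by simp [hk, hjk.ne']⟩

theorem IsMaxSeparated.exists_lower {n : ℕ} {F : Finset (Finset ℕ)}
    (hF : IsMaxSeparated n F) (hne : F ≠ IntervalColl n) :
    ∃ G, IsMaxSeparated n G ∧ StrongRaisingFlip n G F ∧
      ∑ A ∈ G, A.card < ∑ A ∈ F, A.card := by
  obtain ⟨i, j, k, X, hij, hjk, hi, hj, hk, h0, h1, h2, h3, h4, h5, h6⟩ :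
      ∃ i j k X, HasUpperHexagon F i j k X := by
    by_contra hcon
    refine hne (hF.eq_of_subset (isMaxSeparated_intervalColl n) fun A hA => ?_)
    refine mem_intervalColl.2 ⟨hF.subset A hA, fun x y z hxy hyz hx hz => ?_⟩
    by_contra hy
    exact hcon (hF.exists_hexagon hA hxy hyz hx hy hz)
  have hjF : insert j X ∉ F := fun h =>
    not_separated_insert hij hjk hi hj hk (hF.separated _ h6 _ h)
  have hsub := hF.subset _ h5
  have hjX : insert j X ⊆ Finset.Icc 1 n := fun t ht => hsub (by grind)
  have n0 : X ≠ insert i (insert k X) := fun h => hi (h ▸ by simp)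
  have n1 : insert i X ≠ insert i (insert k X) := fun h => by
    have : k ∈ insert i X := h ▸ by simp
    grind
  have n2 : insert k X ≠ insert i (insert k X) := fun h => by
    have : i ∈ insert k X := h ▸ by simp
    grind
  have hjn : j ∉ insert i (insert k X) := by simp [hj, hij.ne', hjk.ne]
  have n3 : insert i (insert j X) ≠ insert i (insert k X) := fun h => hjn (h ▸ by simp)
  have n4 : insert j (insert k X) ≠ insert i (insert k X) := fun h => hjn (h ▸ by simp)
  have n5 : insert i (insert j (insert k X)) ≠ insert i (insert k X) := fun h =>
    hjn (h ▸ by simp)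
  have mem {B : Finset ℕ} (hB : B ∈ F) (hn : B ≠ insert i (insert k X)) :
      B ∈ insert (insert j X) (F.erase (insert i (insert k X))) :=
    Finset.mem_insert_of_mem (Finset.mem_erase.2 ⟨hn, hB⟩)
  have hlow : ∀ B ∈ F, B ≠ insert i (insert k X) → Separated B (insert j X) := fun B hB hn =>
    separated_insert_of_flip hij hjk hi hj hk (hF.separated B hB _ h0)
      (hF.separated B hB _ h3) (hF.separated B hB _ h4) hn
  refine ⟨insert (insert j X) (F.erase (insert i (insert k X))), ⟨?_, ?_, ?_⟩, ?_, ?_⟩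
  · intro B hB
    rcases Finset.mem_insert.1 hB with rfl | hB
    · exact hjX
    · exact hF.subset B (Finset.mem_of_mem_erase hB)
  · intro B hB C hC
    rcases Finset.mem_insert.1 hB with hB | hB <;> rcases Finset.mem_insert.1 hC with hC | hC
    · exact hB ▸ hC ▸ separated_self _
    · exact hB ▸ (hlow C (Finset.mem_of_mem_erase hC) (Finset.ne_of_mem_erase hC)).symm
    · exact hC ▸ hlow B (Finset.mem_of_mem_erase hB) (Finset.ne_of_mem_erase hB)
    · exact hF.separated B (Finset.mem_of_mem_erase hB) C (Finset.mem_of_mem_erase hC)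
  · intro Z hZ hsep
    by_cases hZj : Z = insert j X
    · exact hZj ▸ Finset.mem_insert_self _ _
    have hZik : Separated Z (insert i (insert k X)) :=
      separated_insert_insert_of_flip hij hjk hi hj hk (hsep _ (mem h5 n5)) (hsep _ (mem h1 n1))
        (hsep _ (mem h2 n2)) hZj
    refine mem (hF.mem Z hZ fun B hB => ?_) fun h => ?_
    · by_cases hBik : B = insert i (insert k X)
      · exact hBik ▸ hZik
      · exact hsep B (mem hB hBik)
    · exact not_separated_insert hij hjk hi hj hk (h ▸ hsep _ (Finset.mem_insert_self _ _))
  · refine ⟨i, j, k, X, hsub (by simp), hsub (by simp), hsub (by simp), hij, hjk,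
      hF.subset _ h0, hi, hj, hk, mem h0 n0, mem h1 n1, mem h2 n2, mem h3 n3, mem h4 n4,
      mem h5 n5, Finset.mem_insert_self _ _, ?_⟩
    rw [Finset.erase_insert fun h => hjF (Finset.mem_of_mem_erase h), Finset.insert_erase h6]
  · rw [Finset.sum_insert fun h => hjF (Finset.mem_of_mem_erase h), ← Finset.add_sum_erase F _ h6,
      Finset.card_insert_of_notMem hj,
      Finset.card_insert_of_notMem (by simp [hi, (hij.trans hjk).ne]),
      Finset.card_insert_of_notMem hk]
    omega

/-- The family of the complements in `[n]` of the members of `F`. -/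
def complColl (n : ℕ) (F : Finset (Finset ℕ)) : Finset (Finset ℕ) :=
  F.image fun X => Finset.Icc 1 n \ X

theorem mem_complColl {n : ℕ} {F : Finset (Finset ℕ)} (hF : ∀ A ∈ F, A ⊆ Finset.Icc 1 n)
    {B : Finset ℕ} : B ∈ complColl n F ↔ B ⊆ Finset.Icc 1 n ∧ Finset.Icc 1 n \ B ∈ F := by
  unfold complColl
  constructor
  · intro h
    obtain ⟨A, hA, rfl⟩ := Finset.mem_image.1 h
    exact ⟨Finset.sdiff_subset, by rwa [Finset.sdiff_sdiff_eq_self (hF A hA)]⟩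
  · rintro ⟨hB, h⟩
    exact Finset.mem_image.2 ⟨_, h, Finset.sdiff_sdiff_eq_self hB⟩

theorem complColl_complColl {n : ℕ} {F : Finset (Finset ℕ)}
    (hF : ∀ A ∈ F, A ⊆ Finset.Icc 1 n) : complColl n (complColl n F) = F := by
  ext B
  rw [mem_complColl fun A hA => ((mem_complColl hF).1 hA).1, mem_complColl hF]
  constructor
  · rintro ⟨hB, -, h⟩
    rwa [Finset.sdiff_sdiff_eq_self hB] at h
  · exact fun h => ⟨hF B h, Finset.sdiff_subset, by rwa [Finset.sdiff_sdiff_eq_self (hF B h)]⟩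

theorem Separated.of_sdiff {U A B : Finset ℕ} (hA : A ⊆ U) (hB : B ⊆ U)
    (h : Separated (U \ A) (U \ B)) : Separated A B := by
  constructor <;> rintro ⟨x, y, z, hxy, hyz, ⟨hx, hx'⟩, ⟨hy, hy'⟩, hz, hz'⟩
  · exact h.2 ⟨x, y, z, hxy, hyz, by grind, by grind, by grind⟩
  · exact h.1 ⟨x, y, z, hxy, hyz, by grind, by grind, by grind⟩

theorem IsMaxSeparated.complColl {n : ℕ} {F : Finset (Finset ℕ)} (hF : IsMaxSeparated n F) :
    IsMaxSeparated n (complColl n F) where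
  subset B hB := ((mem_complColl hF.subset).1 hB).1
  separated A hA B hB := by
    rw [mem_complColl hF.subset] at hA hB
    exact .of_sdiff hA.1 hB.1 (hF.separated _ hA.2 _ hB.2)
  mem Z hZ h := by
    refine (mem_complColl hF.subset).2 ⟨hZ, hF.mem _ Finset.sdiff_subset fun B hB => ?_⟩
    have hBs := hF.subset B hB
    refine .of_sdiff Finset.sdiff_subset hBs ?_
    rw [Finset.sdiff_sdiff_eq_self hZ]
    refine h _ ((mem_complColl hF.subset).2 ⟨Finset.sdiff_subset, ?_⟩)
    rwa [Finset.sdiff_sdiff_eq_self hBs]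

theorem insert_insert_sdiff_insert {U X : Finset ℕ} {a b c : ℕ} (ha : a ∈ U) (hb : b ∈ U)
    (hac : a ≠ c) (hbc : b ≠ c) (haX : a ∉ X) (hbX : b ∉ X) :
    insert a (insert b (U \ insert a (insert b (insert c X)))) = U \ insert c X := by
  ext t
  by_cases t = a <;> by_cases t = b <;> simp_all

theorem insert_sdiff_insert_self {U X : Finset ℕ} {a : ℕ} (ha : a ∈ U) (haX : a ∉ X) :
    insert a (U \ insert a X) = U \ X := by
  ext t
  by_cases t = a <;> simp_all

theorem StrongRaisingFlip.complColl {n : ℕ} {F G : Finset (Finset ℕ)}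
    (hF : IsMaxSeparated n F) (hG : IsMaxSeparated n G) (h : StrongRaisingFlip n F G) :
    StrongRaisingFlip n (complColl n G) (complColl n F) := by
  obtain ⟨i, j, k, X, hi', hj', hk', hij, hjk, hX, hi, hj, hk, h0, h1, h2, h3, h4, h5, h6, rfl⟩ :=
    h
  have hik : insert i (insert k X) ∉ F := fun h =>
    not_separated_insert hij hjk hi hj hk (hF.separated _ h _ h6)
  set G := insert (insert i (insert k X)) (F.erase (insert j X)) with hGdef
  have mem {B : Finset ℕ} (hB : B ∈ F) (hn : B ≠ insert j X) : B ∈ G :=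
    Finset.mem_insert_of_mem (Finset.mem_erase.2 ⟨hn, hB⟩)
  have key {B C : Finset ℕ} (hC : C ⊆ Finset.Icc 1 n) (hB : B ∈ G)
      (hBC : ∀ t ∈ Finset.Icc 1 n, t ∈ C ↔ t ∉ B) : C ∈ _root_.complColl n G := by
    refine (mem_complColl hG.subset).2 ⟨hC, ?_⟩
    have : Finset.Icc 1 n \ C = B := by
      have := hG.subset B hB
      grind
    rwa [this]
  have ni {B : Finset ℕ} (h : i ∈ B) : B ≠ insert j X := by grind
  have nk {B : Finset ℕ} (h : k ∈ B) : B ≠ insert j X := by grind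
  refine ⟨i, j, k, Finset.Icc 1 n \ insert i (insert j (insert k X)), hi', hj', hk', hij, hjk,
    Finset.sdiff_subset, by simp, by simp, by simp,
    key ?_ (mem h5 (ni (by simp))) ?_, key ?_ (mem h4 (nk (by simp))) ?_,
    key ?_ (mem h3 (ni (by simp))) ?_, key ?_ (mem h2 (nk (by simp))) ?_,
    key ?_ (mem h1 (ni (by simp))) ?_, key ?_ (mem h0 (by grind)) ?_,
    key ?_ (Finset.mem_insert_self _ _) ?_, ?_⟩
  on_goal 15 =>
    have e1 : insert i (insert k (Finset.Icc 1 n \ insert i (insert j (insert k X)))) =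
        Finset.Icc 1 n \ insert j X := by
      rw [Finset.insert_comm j k]
      exact insert_insert_sdiff_insert hi' hk' hij.ne hjk.ne' hi hk
    have e2 : insert j (Finset.Icc 1 n \ insert i (insert j (insert k X))) =
        Finset.Icc 1 n \ insert i (insert k X) := by
      rw [Finset.insert_comm i j]
      exact insert_sdiff_insert_self hj' (by simp [hij.ne', hjk.ne, hj])
    rw [e1, e2]
    ext B
    rw [Finset.mem_insert, Finset.mem_erase, mem_complColl hF.subset, mem_complColl hG.subset,
      hGdef, Finset.mem_insert, Finset.mem_erase]
    have hjs := hF.subset _ h6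
    have hiks := hG.subset _ (Finset.mem_insert_self _ _)
    constructor
    · rintro ⟨hB, h⟩
      by_cases hBj : Finset.Icc 1 n \ B = insert j X
      · left
        rw [← hBj, Finset.sdiff_sdiff_eq_self hB]
      · refine .inr ⟨fun h' => hik ?_, hB, .inr ⟨hBj, h⟩⟩
        rwa [h', Finset.sdiff_sdiff_eq_self hiks] at h
    · rintro (rfl | ⟨hne, hB, h | h⟩)
      · exact ⟨Finset.sdiff_subset, by rwa [Finset.sdiff_sdiff_eq_self hjs]⟩
      · exact absurd (by rw [← h, Finset.sdiff_sdiff_eq_self hB]) hne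
      · exact ⟨hB, h.2⟩
  all_goals clear mem key ni nk hG hGdef hik h0 h1 h2 h3 h4 h5 h6
  all_goals first
    | simp only [Finset.insert_subset_iff, Finset.sdiff_subset, hi', hj', hk', and_self]
    | intro t ht
      by_cases t = i <;> by_cases t = j <;> by_cases t = k <;> simp_all <;> omega

theorem exists_seq_of_reflTransGen {α : Type*} {r : α → α → Prop} {a b : α}
    (h : Relation.ReflTransGen r a b) :
    ∃ (t : ℕ) (f : ℕ → α), f 0 = a ∧ f t = b ∧ ∀ s < t, r (f s) (f (s + 1)) := by
  induction h with
  | refl => exact ⟨0, fun _ => a, rfl, rfl, by simp⟩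
  | @tail b c _ hbc ih =>
    obtain ⟨t, f, h0, ht, hf⟩ := ih
    refine ⟨t + 1, fun s => if s ≤ t then f s else c, by simp [h0], by simp, fun s hs => ?_⟩
    rcases (Nat.lt_succ_iff.1 hs).eq_or_lt with rfl | hs
    · simpa [ht] using hbc
    · simpa [hs.le, Nat.succ_le_of_lt hs] using hf s hs

/-- A strong raising flip between maximal separated families. -/
def MaxFlip (n : ℕ) (F G : Finset (Finset ℕ)) : Prop :=
  IsMaxSeparated n F ∧ IsMaxSeparated n G ∧ StrongRaisingFlip n F G

theorem exists_flip_seq {n : ℕ} {F G : Finset (Finset ℕ)} (hG : IsMaxSeparated n G)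
    (h : Relation.ReflTransGen (MaxFlip n) F G) :
    ∃ (t : ℕ) (Fs : ℕ → Finset (Finset ℕ)), Fs 0 = F ∧ Fs t = G ∧
      (∀ s ≤ t, IsMaxSColl {X : Finset ℕ | X ⊆ Finset.Icc 1 n} (Fs s)) ∧
      (∀ s < t, StrongRaisingFlip n (Fs s) (Fs (s + 1))) := by
  obtain ⟨t, f, h0, ht, hf⟩ := exists_seq_of_reflTransGen h
  refine ⟨t, f, h0, ht, fun s hs => isMaxSColl_iff.2 ?_, fun s hs => (hf s hs).2.2⟩
  rcases hs.eq_or_lt with rfl | hs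
  · exact ht ▸ hG
  · exact (hf s hs).1

theorem IsMaxSeparated.reflTransGen_intervalColl {n : ℕ} {F : Finset (Finset ℕ)}
    (hF : IsMaxSeparated n F) : Relation.ReflTransGen (MaxFlip n) (IntervalColl n) F := by
  induction hw : ∑ A ∈ F, A.card using Nat.strong_induction_on generalizing F with
  | _ w ih =>
    by_cases h : F = IntervalColl n
    · exact h ▸ .refl
    · obtain ⟨G, hG, hflip, hlt⟩ := hF.exists_lower h
      exact (ih _ (hw ▸ hlt) hG rfl).tail ⟨hG, hF, hflip⟩

theorem IsMaxSeparated.reflTransGen_coIntervalColl {n : ℕ} {F : Finset (Finset ℕ)}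
    (hF : IsMaxSeparated n F) : Relation.ReflTransGen (MaxFlip n) F (CoIntervalColl n) := by
  have h : Relation.ReflTransGen (Function.swap (MaxFlip n)) (_root_.complColl n (IntervalColl n))
      (_root_.complColl n (_root_.complColl n F)) :=
    hF.complColl.reflTransGen_intervalColl.lift _ fun A B hAB =>
      ⟨hAB.2.1.complColl, hAB.1.complColl, hAB.2.2.complColl hAB.1 hAB.2.1⟩
  rw [complColl_complColl hF.subset] at h
  exact Relation.reflTransGen_swap.1 h

/-- every maximal s-collection in `2^[n]` is reachable from `I_n`,
and reaches `co-I_n`, by finite sequences of strong raising flips through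
maximal s-collections; in particular `I_n` and `co-I_n` are maximal
s-collections. -/
theorem max_s_collection_between_intervals_and_cointervals (n : ℕ) (hn : 1 ≤ n) :
    IsMaxSColl {X : Finset ℕ | X ⊆ Finset.Icc 1 n} (IntervalColl n) ∧
    IsMaxSColl {X : Finset ℕ | X ⊆ Finset.Icc 1 n} (CoIntervalColl n) ∧
    ∀ F : Finset (Finset ℕ), IsMaxSColl {X : Finset ℕ | X ⊆ Finset.Icc 1 n} F →
      (∃ (t : ℕ) (Fs : ℕ → Finset (Finset ℕ)),
        Fs 0 = IntervalColl n ∧ Fs t = F ∧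
        (∀ s ≤ t, IsMaxSColl {X : Finset ℕ | X ⊆ Finset.Icc 1 n} (Fs s)) ∧
        (∀ s < t, StrongRaisingFlip n (Fs s) (Fs (s + 1)))) ∧
      (∃ (t : ℕ) (Fs : ℕ → Finset (Finset ℕ)),
        Fs 0 = F ∧ Fs t = CoIntervalColl n ∧
        (∀ s ≤ t, IsMaxSColl {X : Finset ℕ | X ⊆ Finset.Icc 1 n} (Fs s)) ∧
        (∀ s < t, StrongRaisingFlip n (Fs s) (Fs (s + 1)))) := by
  have hI := isMaxSeparated_intervalColl n
  have hco : IsMaxSeparated n (CoIntervalColl n) := hI.complColl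
  refine ⟨isMaxSColl_iff.2 hI, isMaxSColl_iff.2 hco, fun F hF => ?_⟩
  rw [isMaxSColl_iff] at hF
  exact ⟨exists_flip_seq hF hF.reflTransGen_intervalColl,
    exists_flip_seq hco hF.reflTransGen_coIntervalColl⟩
end

section
/- The domain Δ_5^2 = {X ⊆ [5] : |X| = 2} is not s-pure: there exist two maximal s-collections in Δ_5^2 having different cardinalities. -/
open Finset

instance (A B : Finset ℕ) : Decidable (StronglySep A B) := by
  unfold StronglySep LessDot SetLT
  infer_instance

instance (F : Finset (Finset ℕ)) : Decidable (IsSColl F) := by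
  unfold IsSColl
  infer_instance

/-- An s-collection in a finite domain is maximal once every member of the domain that is
strongly separated from the whole collection already belongs to it. -/
theorem isMaxSColl_of_forall_mem {D F : Finset (Finset ℕ)} (hFD : F ⊆ D) (hF : IsSColl F)
    (hmax : ∀ A ∈ D, (∀ B ∈ F, StronglySep A B) → A ∈ F) :
    IsMaxSColl (D : Set (Finset ℕ)) F :=
  ⟨coe_subset.2 hFD, hF, fun _ hGD hG hFG =>
    hFG.antisymm fun A hA => hmax A (hGD hA) fun B hB => hG A hA B (hFG hB)⟩

/-- the discrete Grassmannian `Δ_5^2` is not s-pure: it has two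
maximal s-collections of different cardinalities. -/
theorem delta_5_2_not_s_pure :
    ∃ F G : Finset (Finset ℕ),
      IsMaxSColl {X : Finset ℕ | X ⊆ Finset.Icc 1 5 ∧ X.card = 2} F ∧
      IsMaxSColl {X : Finset ℕ | X ⊆ Finset.Icc 1 5 ∧ X.card = 2} G ∧
      F.card ≠ G.card := by
  have hD : {X : Finset ℕ | X ⊆ Icc 1 5 ∧ X.card = 2} =
      (powersetCard 2 (Icc 1 5) : Finset (Finset ℕ)) := by
    ext X
    simp
  rw [hD]
  refine ⟨{{1, 2}, {1, 3}, {1, 4}, {1, 5}, {4, 5}},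
    {{1, 2}, {1, 3}, {2, 3}, {3, 4}, {3, 5}, {4, 5}},
    isMaxSColl_of_forall_mem ?_ ?_ ?_, isMaxSColl_of_forall_mem ?_ ?_ ?_, ?_⟩ <;>
  decide
end
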